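/- arXiv:1604.04952 — 2 statements merged into one kernel-verified Lean document; each statement's English description precedes it below -/
import Mathlib

section
/- Let A ∈ M_d(ℂ)^g and suppose the free spectrahedron D_A is bounded. For every t > 1 there exist a positive integer m and an m×m matrix-valued analytic free polynomial Q in g variables such that for every n and every X ∈ M_n(ℂ)^g: (i) if X ∈ D_A(n) then ‖Q(X)‖ < 1, and (ii) if ‖Q(X)‖ < 1 then t^{-1}X ∈ D_A(n). That is, D_A ⊆ G_Q ⊆ tD_A, where G_Q = {X : ‖Q(X)‖ < 1}. -/
open scoped Kronecker Matrix ComplexOrder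

/-- The product of matrices from the tuple `X` along the word `w` (empty word ↦ identity). -/
noncomputable def wordProd {g n : ℕ} (X : Fin g → Matrix (Fin n) (Fin n) ℂ)
    (w : List (Fin g)) : Matrix (Fin n) (Fin n) ℂ :=
  (w.map X).prod

/-- `Λ_A(X) = Σ_j A_j ⊗ X_j`. -/
noncomputable def lamEval {g d n : ℕ} (A : Fin g → Matrix (Fin d) (Fin d) ℂ)
    (X : Fin g → Matrix (Fin n) (Fin n) ℂ) : Matrix (Fin d × Fin n) (Fin d × Fin n) ℂ :=
  ∑ j : Fin g, (A j) ⊗ₖ (X j)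

/-- The monic linear pencil `L_A(X) = I⊗I + Σ_j A_j ⊗ X_j + Σ_j A_j^* ⊗ X_j^*`. -/
noncomputable def pencil {g d n : ℕ} (A : Fin g → Matrix (Fin d) (Fin d) ℂ)
    (X : Fin g → Matrix (Fin n) (Fin n) ℂ) : Matrix (Fin d × Fin n) (Fin d × Fin n) ℂ :=
  1 + lamEval A X + (lamEval A X)ᴴ

/-- The operator (ℓ²→ℓ²) norm of a square complex matrix. -/
noncomputable def opN {m : Type*} [Fintype m] [DecidableEq m] (T : Matrix m m ℂ) : ℝ :=
  ‖Matrix.toEuclideanCLM (𝕜 := ℂ) T‖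

/-- The free spectrahedron `D_A` is bounded. -/
def BoundedFS {g d : ℕ} (A : Fin g → Matrix (Fin d) (Fin d) ℂ) : Prop :=
  ∃ N : ℝ, ∀ (n : ℕ) (X : Fin g → Matrix (Fin n) (Fin n) ℂ),
    (pencil A X).PosSemidef → ∀ j : Fin g, opN (X j) ≤ N

/-- Evaluation of an `m × m` matrix-valued analytic free polynomial
(a finitely supported family of coefficients indexed by words) at a tuple `X`:
`Q(X) = Σ_w Q_w ⊗ X^w`. -/
noncomputable def fpEval {g m n : ℕ} (Q : List (Fin g) →₀ Matrix (Fin m) (Fin m) ℂ)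
    (X : Fin g → Matrix (Fin n) (Fin n) ℂ) : Matrix (Fin m × Fin n) (Fin m × Fin n) ℂ :=
  Q.sum fun w c => c ⊗ₖ wordProd X w

section CStarAlgebra

lemma star_mul_self_sub_smul_one {B : Type*} [CStarAlgebra B] (a : B) (c : ℝ) :
    star (a - (c : ℂ) • (1 : B)) * (a - (c : ℂ) • (1 : B)) =
      star a * a - c • (a + star a) + (c ^ 2) • (1 : B) := by
  simp only [Complex.coe_smul, star_sub, star_smul, star_one, star_trivial, sub_mul, mul_sub,
    smul_mul_assoc, mul_smul_comm, one_mul, mul_one]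
  module

variable {B : Type*} [CStarAlgebra B] [PartialOrder B] [StarOrderedRing B]

lemma CStarAlgebra.norm_le_iff_star_mul_self_le (a : B) {r : ℝ} (hr : 0 ≤ r) :
    ‖a‖ ≤ r ↔ star a * a ≤ ((r ^ 2 : ℝ) : ℂ) • (1 : B) := by
  rw [Complex.coe_smul, ← Algebra.algebraMap_eq_smul_one,
    ← CStarAlgebra.norm_le_iff_le_algebraMap _ (sq_nonneg r) (star_mul_self_nonneg a),
    CStarRing.norm_star_mul_self, ← sq, sq_le_sq₀ (norm_nonneg a) hr]

/-- Elements of a half-plane type region that are bounded by `R` lie in every large enough ball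
with centre `c`. -/
lemma norm_sub_smul_one_le {a : B} {R c ρ : ℝ} (ha : 0 ≤ 1 + a + star a) (haR : ‖a‖ ≤ R)
    (hc : 0 ≤ c) (hρ : 0 ≤ ρ) (h : R ^ 2 + c + c ^ 2 ≤ ρ ^ 2) :
    ‖a - (c : ℂ) • (1 : B)‖ ≤ ρ := by
  have hR : 0 ≤ R := (norm_nonneg a).trans haR
  rw [CStarAlgebra.norm_le_iff_star_mul_self_le _ hR, Complex.coe_smul, ← sub_nonneg] at haR
  rw [CStarAlgebra.norm_le_iff_star_mul_self_le _ hρ, star_mul_self_sub_smul_one,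
    Complex.coe_smul, ← sub_nonneg]
  have h₁ : 0 ≤ c • (1 + a + star a) := smul_nonneg hc ha
  have h₂ : 0 ≤ (ρ ^ 2 - (R ^ 2 + c + c ^ 2)) • (1 : B) :=
    smul_nonneg (sub_nonneg.2 h) zero_le_one
  convert add_nonneg (add_nonneg haR h₁) h₂ using 1
  module

/-- Balls with centre `c` lie in a half-plane type region. -/
lemma nonneg_of_norm_sub_smul_one_le {a : B} {c ρ t : ℝ} (hc : 0 < c) (hρ : 0 ≤ ρ)
    (h : ρ ^ 2 ≤ c ^ 2 + c * t) (ha : ‖a - (c : ℂ) • (1 : B)‖ ≤ ρ) :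
    0 ≤ t • (1 : B) + a + star a := by
  rw [CStarAlgebra.norm_le_iff_star_mul_self_le _ hρ, star_mul_self_sub_smul_one,
    Complex.coe_smul, ← sub_nonneg] at ha
  have h₁ : 0 ≤ (c ^ 2 + c * t - ρ ^ 2) • (1 : B) := smul_nonneg (sub_nonneg.2 h) zero_le_one
  have h₂ := smul_nonneg (inv_nonneg.2 hc.le)
    (add_nonneg (add_nonneg ha h₁) (star_mul_self_nonneg a))
  convert h₂ using 1
  match_scalars <;> field_simp <;> ring

end CStarAlgebra

section Kronecker

open scoped MatrixOrder Matrix.Norms.L2Operator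

variable {m n : Type*} [Fintype m] [DecidableEq m] [Fintype n] [DecidableEq n]

lemma Matrix.sub_kronecker {R l l' p q : Type*} [Ring R] (S₁ S₂ : Matrix l l' R)
    (T : Matrix p q R) : (S₁ - S₂) ⊗ₖ T = S₁ ⊗ₖ T - S₂ ⊗ₖ T := by
  ext
  simp [sub_mul]

lemma Matrix.kronecker_sub {R l l' p q : Type*} [Ring R] (S : Matrix l l' R)
    (T₁ T₂ : Matrix p q R) : S ⊗ₖ (T₁ - T₂) = S ⊗ₖ T₁ - S ⊗ₖ T₂ := by
  ext
  simp [mul_sub]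

lemma Matrix.l2_opNorm_kronecker_one_le (S : Matrix m m ℂ) :
    ‖S ⊗ₖ (1 : Matrix n n ℂ)‖ ≤ ‖S‖ := by
  have h := (CStarAlgebra.norm_le_iff_star_mul_self_le S (norm_nonneg S)).1 le_rfl
  rw [CStarAlgebra.norm_le_iff_star_mul_self_le _ (norm_nonneg S), Matrix.le_iff]
  convert (Matrix.le_iff.1 h).kronecker (Matrix.PosSemidef.one (n := n) (R := ℂ)) using 1
  simp [Matrix.star_eq_conjTranspose, Matrix.conjTranspose_kronecker, ← Matrix.mul_kronecker_mul,
    Matrix.sub_kronecker, Matrix.smul_kronecker]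

lemma Matrix.l2_opNorm_one_kronecker_le (T : Matrix n n ℂ) :
    ‖(1 : Matrix m m ℂ) ⊗ₖ T‖ ≤ ‖T‖ := by
  have h := (CStarAlgebra.norm_le_iff_star_mul_self_le T (norm_nonneg T)).1 le_rfl
  rw [CStarAlgebra.norm_le_iff_star_mul_self_le _ (norm_nonneg T), Matrix.le_iff]
  convert (Matrix.PosSemidef.one (n := m) (R := ℂ)).kronecker (Matrix.le_iff.1 h) using 1
  simp [Matrix.star_eq_conjTranspose, Matrix.conjTranspose_kronecker, ← Matrix.mul_kronecker_mul,
    Matrix.kronecker_sub, Matrix.kronecker_smul]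

lemma Matrix.l2_opNorm_kronecker_le (S : Matrix m m ℂ) (T : Matrix n n ℂ) :
    ‖S ⊗ₖ T‖ ≤ ‖S‖ * ‖T‖ := by
  calc ‖S ⊗ₖ T‖ = ‖(S ⊗ₖ (1 : Matrix n n ℂ)) * ((1 : Matrix m m ℂ) ⊗ₖ T)‖ := by
        rw [← Matrix.mul_kronecker_mul, mul_one, one_mul]
    _ ≤ _ := (norm_mul_le _ _).trans <| mul_le_mul (l2_opNorm_kronecker_one_le S)
        (l2_opNorm_one_kronecker_le T) (norm_nonneg _) (norm_nonneg _)

end Kronecker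

open scoped Matrix.Norms.L2Operator in
lemma norm_lamEval_le {g d n : ℕ} (A : Fin g → Matrix (Fin d) (Fin d) ℂ)
    (X : Fin g → Matrix (Fin n) (Fin n) ℂ) :
    ‖lamEval A X‖ ≤ ∑ j, ‖A j‖ * ‖X j‖ :=
  norm_sum_le_of_le _ fun j _ => Matrix.l2_opNorm_kronecker_le (A j) (X j)

/-- The affine free polynomial `ρ⁻¹ (Λ_A - c)`. -/
noncomputable def affinePoly {g d : ℕ} (A : Fin g → Matrix (Fin d) (Fin d) ℂ) (c ρ : ℝ) :
    List (Fin g) →₀ Matrix (Fin d) (Fin d) ℂ :=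
  (ρ : ℂ)⁻¹ • (∑ j, Finsupp.single [j] (A j) + Finsupp.single [] (-((c : ℂ) • 1)))

lemma fpEval_affinePoly {g d n : ℕ} (A : Fin g → Matrix (Fin d) (Fin d) ℂ) (c ρ : ℝ)
    (X : Fin g → Matrix (Fin n) (Fin n) ℂ) :
    fpEval (affinePoly A c ρ) X = (ρ : ℂ)⁻¹ • (lamEval A X - (c : ℂ) • 1) := by
  have h_add (w : List (Fin g)) (S T : Matrix (Fin d) (Fin d) ℂ) :
      (S + T) ⊗ₖ wordProd X w = S ⊗ₖ wordProd X w + T ⊗ₖ wordProd X w :=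
    Matrix.add_kronecker _ _ _
  have h_zero (w : List (Fin g)) : (0 : Matrix (Fin d) (Fin d) ℂ) ⊗ₖ wordProd X w = 0 :=
    Matrix.zero_kronecker _
  rw [fpEval, affinePoly, Finsupp.sum_smul_index' h_zero]
  simp only [Matrix.smul_kronecker]
  rw [← Finsupp.smul_sum, Finsupp.sum_add_index' h_zero h_add,
    ← Finsupp.sum_finsetSum_index h_zero h_add]
  simp [Finsupp.sum_single_index, wordProd, lamEval, sub_eq_add_neg, ← neg_smul,
    Matrix.smul_kronecker]

open scoped MatrixOrder Matrix.Norms.L2Operator in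
lemma posSemidef_pencil_inv_smul {g d n : ℕ} (A : Fin g → Matrix (Fin d) (Fin d) ℂ)
    (X : Fin g → Matrix (Fin n) (Fin n) ℂ) {t : ℝ} (ht : 0 < t)
    (h : 0 ≤ t • (1 : Matrix (Fin d × Fin n) (Fin d × Fin n) ℂ) + lamEval A X +
      star (lamEval A X)) :
    (pencil A (fun j => ((t : ℂ)⁻¹) • X j)).PosSemidef := by
  have h_lam : lamEval A (fun j => ((t : ℂ)⁻¹) • X j) = (t⁻¹ : ℝ) • lamEval A X := by
    simp only [lamEval, Matrix.kronecker_smul, ← Finset.smul_sum, ← Complex.ofReal_inv,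
      Complex.coe_smul]
  rw [← Matrix.nonneg_iff_posSemidef, pencil, h_lam]
  convert smul_nonneg (inv_nonneg.2 ht.le) h using 1
  rw [Matrix.conjTranspose_smul, star_trivial, Matrix.star_eq_conjTranspose, smul_add, smul_add,
    inv_smul_smul₀ ht.ne']

open scoped MatrixOrder Matrix.Norms.L2Operator in
lemma BoundedFS.exists_norm_lamEval_le {g d : ℕ} {A : Fin g → Matrix (Fin d) (Fin d) ℂ}
    (hbdd : BoundedFS A) :
    ∃ R : ℝ, ∀ (n : ℕ) (X : Fin g → Matrix (Fin n) (Fin n) ℂ),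
      (pencil A X).PosSemidef → ‖lamEval A X‖ ≤ R := by
  obtain ⟨N, hN⟩ := hbdd
  exact ⟨∑ j, ‖A j‖ * N, fun n X hX => (norm_lamEval_le A X).trans <|
    Finset.sum_le_sum fun j _ => mul_le_mul_of_nonneg_left (hN n X hX j) (norm_nonneg _)⟩

open scoped Matrix.Norms.L2Operator in
lemma opN_fpEval_affinePoly_lt_one_iff {g d n : ℕ} (A : Fin g → Matrix (Fin d) (Fin d) ℂ)
    {c ρ : ℝ} (hρ : 0 < ρ) (X : Fin g → Matrix (Fin n) (Fin n) ℂ) :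
    opN (fpEval (affinePoly A c ρ) X) < 1 ↔ ‖lamEval A X - (c : ℂ) • 1‖ < ρ := by
  rw [opN, ← Matrix.cstar_norm_def, fpEval_affinePoly, norm_smul, norm_inv, Complex.norm_real,
    Real.norm_of_nonneg hρ.le, inv_mul_lt_iff₀ hρ, mul_one]

open scoped MatrixOrder in
lemma pencil_posSemidef_iff {g d n : ℕ} (A : Fin g → Matrix (Fin d) (Fin d) ℂ)
    (X : Fin g → Matrix (Fin n) (Fin n) ℂ) :
    (pencil A X).PosSemidef ↔ 0 ≤ 1 + lamEval A X + star (lamEval A X) :=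
  Matrix.nonneg_iff_posSemidef.symm

open scoped MatrixOrder Matrix.Norms.L2Operator in
lemma opN_fpEval_affinePoly_lt_one {g d n : ℕ} {A : Fin g → Matrix (Fin d) (Fin d) ℂ}
    {X : Fin g → Matrix (Fin n) (Fin n) ℂ} {R c ρ : ℝ} (hX : (pencil A X).PosSemidef)
    (hR : ‖lamEval A X‖ ≤ R) (hc : 0 ≤ c) (hρ : 0 < ρ) (h : R ^ 2 + c + c ^ 2 < ρ ^ 2) :
    opN (fpEval (affinePoly A c ρ) X) < 1 := by
  rw [opN_fpEval_affinePoly_lt_one_iff A hρ]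
  refine (norm_sub_smul_one_le ((pencil_posSemidef_iff A X).1 hX) hR hc (Real.sqrt_nonneg _)
    (Real.sq_sqrt (by positivity)).ge).trans_lt ?_
  exact (Real.sqrt_lt' hρ).2 h

open scoped MatrixOrder Matrix.Norms.L2Operator in
lemma posSemidef_pencil_of_opN_lt_one {g d n : ℕ} {A : Fin g → Matrix (Fin d) (Fin d) ℂ}
    {X : Fin g → Matrix (Fin n) (Fin n) ℂ} {c ρ t : ℝ} (hc : 0 < c) (hρ : 0 < ρ) (ht : 0 < t)
    (h : ρ ^ 2 ≤ c ^ 2 + c * t) (hX : opN (fpEval (affinePoly A c ρ) X) < 1) :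
    (pencil A (fun j => ((t : ℂ)⁻¹) • X j)).PosSemidef := by
  rw [opN_fpEval_affinePoly_lt_one_iff A hρ] at hX
  exact posSemidef_pencil_inv_smul A X ht (nonneg_of_norm_sub_smul_one_le hc hρ.le h hX.le)

/-- If `D_A` is bounded then for every `t > 1` there is a matrix-valued analytic free
polynomial `Q` with `D_A ⊆ G_Q ⊆ t·D_A`, where `G_Q = {X : ‖Q(X)‖ < 1}`. -/
theorem spectrahedron_pseudoconvex_approximation {d g : ℕ}
    (A : Fin g → Matrix (Fin d) (Fin d) ℂ) (hbdd : BoundedFS A) :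
    ∀ t : ℝ, 1 < t →
      ∃ m : ℕ, 0 < m ∧
        ∃ Q : List (Fin g) →₀ Matrix (Fin m) (Fin m) ℂ,
          ∀ (n : ℕ) (X : Fin g → Matrix (Fin n) (Fin n) ℂ),
            ((pencil A X).PosSemidef → opN (fpEval Q X) < 1) ∧
            (opN (fpEval Q X) < 1 →
              (pencil A (fun j => ((t : ℂ)⁻¹) • X j)).PosSemidef) := by
  intro t ht
  obtain rfl | hd := d.eq_zero_or_pos
  · refine ⟨1, one_pos, 0, fun n X => ⟨fun _ => by simp [fpEval, opN], fun _ => ?_⟩⟩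
    convert Matrix.PosSemidef.zero (R := ℂ)
    exact Subsingleton.elim _ _
  obtain ⟨R, hR⟩ := hbdd.exists_norm_lamEval_le
  obtain ⟨c, hc, hcR⟩ : ∃ c : ℝ, 0 < c ∧ c * (t - 1) = R ^ 2 + 1 :=
    ⟨(R ^ 2 + 1) / (t - 1), div_pos (by positivity) (sub_pos.2 ht),
      div_mul_cancel₀ _ (sub_pos.2 ht).ne'⟩
  have ht₀ : 0 < t := one_pos.trans ht
  have hρ_sq : √(c ^ 2 + c * t) ^ 2 = c ^ 2 + c * t := Real.sq_sqrt (by positivity)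
  have hρ : 0 < √(c ^ 2 + c * t) := Real.sqrt_pos.2 (by positivity)
  exact ⟨d, hd, affinePoly A c √(c ^ 2 + c * t), fun n X =>
    ⟨fun hX => opN_fpEval_affinePoly_lt_one hX (hR n X hX) hc.le hρ (by linarith),
      posSemidef_pencil_of_opN_lt_one hc hρ ht₀ hρ_sq.le⟩⟩
end

section
/- Let A ∈ M_d(ℂ)^g with the free spectrahedron D_A bounded, and let Q be a matrix-valued analytic free polynomial in g variables such that ‖Q(X)‖ < 1 for every n and every X ∈ D_A(n). Then there exists s > 1 such that s·‖Q(X)‖ ≤ 1 for every n and every X ∈ D_A(n); in particular sup{‖Q(X)‖ : n ∈ ℕ, X ∈ D_A(n)} < 1. -/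
open scoped Kronecker Matrix ComplexOrder

open scoped Matrix.Norms.L2Operator

lemma opN_eq_norm {ι : Type*} [Fintype ι] [DecidableEq ι] (T : Matrix ι ι ℂ) : opN T = ‖T‖ :=
  rfl

lemma pencil_isHermitian {g d n : ℕ} (A : Fin g → Matrix (Fin d) (Fin d) ℂ)
    (X : Fin g → Matrix (Fin n) (Fin n) ℂ) : (pencil A X).IsHermitian := by
  simp only [Matrix.IsHermitian, pencil, Matrix.conjTranspose_add, Matrix.conjTranspose_one,
    Matrix.conjTranspose_conjTranspose]
  abel

lemma continuous_kronecker_right {l m n p : Type*} (c : Matrix l m ℂ) :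
    Continuous fun B : Matrix n p ℂ => c ⊗ₖ B := by
  refine continuous_matrix fun i j => ?_
  simp only [Matrix.kroneckerMap_apply]
  exact continuous_const.mul (continuous_id.matrix_elem _ _)

lemma continuous_pencil {g d n : ℕ} (A : Fin g → Matrix (Fin d) (Fin d) ℂ) :
    Continuous fun X : Fin g → Matrix (Fin n) (Fin n) ℂ => pencil A X := by
  have h : Continuous fun X : Fin g → Matrix (Fin n) (Fin n) ℂ => lamEval A X :=
    continuous_finsetSum _ fun j _ =>
      (continuous_kronecker_right (A j)).comp (continuous_apply j)
  exact (continuous_const.add h).add h.matrix_conjTranspose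

lemma continuous_wordProd {g n : ℕ} (w : List (Fin g)) :
    Continuous fun X : Fin g → Matrix (Fin n) (Fin n) ℂ => wordProd X w := by
  induction w with
  | nil => exact continuous_const
  | cons j w ih =>
    have h : (fun X : Fin g → Matrix (Fin n) (Fin n) ℂ => wordProd X (j :: w)) =
        fun X => X j * wordProd X w := by
      funext X; simp [wordProd]
    rw [h]
    exact (continuous_apply j).matrix_mul ih

lemma continuous_fpEval {g m n : ℕ} (Q : List (Fin g) →₀ Matrix (Fin m) (Fin m) ℂ) :
    Continuous fun X : Fin g → Matrix (Fin n) (Fin n) ℂ => fpEval Q X :=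
  continuous_finsetSum _ fun w _ => (continuous_kronecker_right (Q w)).comp (continuous_wordProd w)

/-- Each level of a bounded free spectrahedron is compact. -/
lemma isCompact_spectrahedron_level {g d : ℕ} {A : Fin g → Matrix (Fin d) (Fin d) ℂ}
    (hbdd : BoundedFS A) (n : ℕ) :
    IsCompact {X : Fin g → Matrix (Fin n) (Fin n) ℂ | (pencil A X).PosSemidef} := by
  obtain ⟨N, hN⟩ := hbdd
  have : ProperSpace (Fin g → Matrix (Fin n) (Fin n) ℂ) := FiniteDimensional.proper ℂ _
  refine Metric.isCompact_of_isClosed_isBounded ?_ ?_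
  · have h : {X : Fin g → Matrix (Fin n) (Fin n) ℂ | (pencil A X).PosSemidef} =
        ⋂ v : Fin d × Fin n → ℂ, {X | 0 ≤ star v ⬝ᵥ (pencil A X *ᵥ v)} := by
      ext X
      simp [Matrix.posSemidef_iff_dotProduct_mulVec, pencil_isHermitian]
    rw [h]
    refine isClosed_iInter fun v => isClosed_le continuous_const ?_
    exact continuous_const.dotProduct ((continuous_pencil A).matrix_mulVec continuous_const)
  · refine isBounded_iff_forall_norm_le.2 ⟨max N 0, fun X hX => ?_⟩
    refine (pi_norm_le_iff_of_nonneg (le_max_right _ _)).2 fun j => ?_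
    exact (hN n X hX j).trans (le_max_left _ _)

/-- A strict bound on one level of a bounded free spectrahedron is uniform. -/
lemma exists_uniform_bound_on_level {d g m : ℕ} {A : Fin g → Matrix (Fin d) (Fin d) ℂ}
    (hbdd : BoundedFS A) (Q : List (Fin g) →₀ Matrix (Fin m) (Fin m) ℂ) (n : ℕ)
    (hQ : ∀ X : Fin g → Matrix (Fin n) (Fin n) ℂ,
      (pencil A X).PosSemidef → opN (fpEval Q X) < 1) :
    ∃ c < 1, ∀ X : Fin g → Matrix (Fin n) (Fin n) ℂ,
      (pencil A X).PosSemidef → opN (fpEval Q X) ≤ c := by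
  rcases Set.eq_empty_or_nonempty
    {X : Fin g → Matrix (Fin n) (Fin n) ℂ | (pencil A X).PosSemidef} with h | h
  · exact ⟨0, one_pos, fun X hX => (Set.eq_empty_iff_forall_notMem.1 h X hX).elim⟩
  · obtain ⟨X₀, hX₀, hmax⟩ := (isCompact_spectrahedron_level hbdd n).exists_isMaxOn h
      (continuous_fpEval Q).norm.continuousOn
    exact ⟨_, hQ X₀ hX₀, fun X hX => hmax hX⟩

/-- Every subspace of `ℂⁿ` is the range of a matrix with orthonormal columns. -/
lemma exists_isometry_matrix {n : ℕ} (V : Submodule ℂ (EuclideanSpace ℂ (Fin n))) :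
    ∃ W : Matrix (Fin n) (Fin (Module.finrank ℂ V)) ℂ, Wᴴ * W = 1 ∧
      ∀ x ∈ V, (W * Wᴴ) *ᵥ x.ofLp = x.ofLp := by
  let b := stdOrthonormalBasis ℂ V
  refine ⟨Matrix.of fun p i => (b i : EuclideanSpace ℂ (Fin n)) p, ?_, fun x hx => ?_⟩
  · ext i j
    have h := orthonormal_iff_ite.1 b.orthonormal i j
    rw [Submodule.coe_inner, PiLp.inner_apply] at h
    simpa [Matrix.mul_apply, Matrix.one_apply, mul_comm] using h
  · have h := congrArg (fun y : V => (y : EuclideanSpace ℂ (Fin n))) (b.sum_repr' ⟨x, hx⟩)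
    ext p
    have hp := congrArg (fun y : EuclideanSpace ℂ (Fin n) => y p) h
    simp only [Submodule.coe_inner, Submodule.coe_sum, Submodule.coe_smul, PiLp.inner_apply,
      WithLp.ofLp_sum, WithLp.ofLp_smul, Finset.sum_apply, Pi.smul_apply, smul_eq_mul] at hp
    rw [← Matrix.mulVec_mulVec, ← hp]
    simp [Matrix.mulVec, dotProduct, mul_comm]

lemma pencil_compress {g d n k : ℕ} (A : Fin g → Matrix (Fin d) (Fin d) ℂ)
    (X : Fin g → Matrix (Fin n) (Fin n) ℂ) {W : Matrix (Fin n) (Fin k) ℂ} (hW : Wᴴ * W = 1) :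
    pencil A (fun j => Wᴴ * X j * W) =
      ((1 : Matrix (Fin d) (Fin d) ℂ) ⊗ₖ W)ᴴ * pencil A X * ((1 : Matrix (Fin d) (Fin d) ℂ) ⊗ₖ W) := by
  have h : lamEval A (fun j => Wᴴ * X j * W) =
      ((1 : Matrix (Fin d) (Fin d) ℂ) ⊗ₖ W)ᴴ * lamEval A X * ((1 : Matrix (Fin d) (Fin d) ℂ) ⊗ₖ W) := by
    simp only [lamEval, Matrix.mul_sum, Matrix.sum_mul, Matrix.conjTranspose_kronecker,
      ← Matrix.mul_kronecker_mul, Matrix.conjTranspose_one, one_mul, mul_one]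
  have h1 : ((1 : Matrix (Fin d) (Fin d) ℂ) ⊗ₖ W)ᴴ * ((1 : Matrix (Fin d) (Fin d) ℂ) ⊗ₖ W) = 1 := by
    simp [Matrix.conjTranspose_kronecker, ← Matrix.mul_kronecker_mul, hW]
  rw [pencil, h]
  simp only [pencil, Matrix.mul_add, Matrix.add_mul, Matrix.mul_one, h1,
    Matrix.conjTranspose_mul, Matrix.conjTranspose_conjTranspose, Matrix.mul_assoc]

lemma kronecker_mulVec_congr {l m n p : Type*} [Fintype m] [Fintype n]
    (c : Matrix l m ℂ) {B B' : Matrix p n ℂ} {v : m × n → ℂ}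
    (h : ∀ i, (B *ᵥ fun q => v (i, q)) = B' *ᵥ fun q => v (i, q)) :
    (c ⊗ₖ B) *ᵥ v = (c ⊗ₖ B') *ᵥ v := by
  have key (C : Matrix p n ℂ) (a : l × p) :
      ((c ⊗ₖ C) *ᵥ v) a = ∑ i, c a.1 i * (C *ᵥ fun q => v (i, q)) a.2 := by
    simp [Matrix.mulVec, dotProduct, Fintype.sum_prod_type, Finset.mul_sum, mul_assoc]
  funext a
  simp [key, h]

lemma norm_le_one_of_conjTranspose_mul_self {l m : Type*} [Fintype l] [Fintype m]
    [DecidableEq l] [DecidableEq m] {U : Matrix l m ℂ} (h : Uᴴ * U = 1) : ‖U‖ ≤ 1 := by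
  have h1 : ‖(1 : Matrix m m ℂ)‖ ≤ 1 := by
    rw [← Matrix.diagonal_one, Matrix.l2_opNorm_diagonal]
    exact (pi_norm_le_iff_of_nonneg zero_le_one).2 fun i => by simp
  have h2 := Matrix.l2_opNorm_conjTranspose_mul_self U
  rw [h] at h2
  nlinarith [norm_nonneg U]

/-- Compressing to a subspace that contains `X^w' u` for all suffixes `w'` of `w` does not change
`X^w u`. -/
lemma wordProd_compress_mulVec {g n k : ℕ} (X : Fin g → Matrix (Fin n) (Fin n) ℂ)
    (W : Matrix (Fin n) (Fin k) ℂ) (u : Fin n → ℂ) (w : List (Fin g))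
    (h : ∀ w', w' <:+ w → (W * Wᴴ) *ᵥ (wordProd X w' *ᵥ u) = wordProd X w' *ᵥ u) :
    (W * wordProd (fun j => Wᴴ * X j * W) w * Wᴴ) *ᵥ u = wordProd X w *ᵥ u := by
  induction w with
  | nil => simpa [wordProd] using h [] (List.suffix_refl _)
  | cons j w ih =>
    have hw := ih fun w' hw' => h w' (hw'.trans (List.suffix_cons j w))
    rw [← h _ (List.suffix_refl _)]
    simp only [wordProd, List.map_cons, List.prod_cons] at hw ⊢
    rw [← Matrix.mulVec_mulVec u (X j), ← hw]
    simp only [Matrix.mulVec_mulVec, Matrix.mul_assoc]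

/-- The value of a free polynomial on a vector is seen on a compression of the tuple to a space
whose dimension depends only on the polynomial. -/
lemma exists_compression {d g m n : ℕ} (A : Fin g → Matrix (Fin d) (Fin d) ℂ)
    (Q : List (Fin g) →₀ Matrix (Fin m) (Fin m) ℂ) (X : Fin g → Matrix (Fin n) (Fin n) ℂ)
    (hX : (pencil A X).PosSemidef) (v : EuclideanSpace ℂ (Fin m × Fin n)) :
    ∃ k ≤ m * (Q.support.biUnion fun w => w.tails.toFinset).card,
      ∃ Y : Fin g → Matrix (Fin k) (Fin k) ℂ, (pencil A Y).PosSemidef ∧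
        ‖WithLp.toLp 2 (fpEval Q X *ᵥ v.ofLp)‖ ≤ opN (fpEval Q Y) * ‖v‖ := by
  set S := Q.support.biUnion fun w => w.tails.toFinset with hS
  let f : Fin m × S → EuclideanSpace ℂ (Fin n) := fun a =>
    WithLp.toLp 2 (wordProd X a.2.1 *ᵥ fun q => v (a.1, q))
  let V := Submodule.span ℂ (Set.range f)
  obtain ⟨W, hW, hP⟩ := exists_isometry_matrix V
  refine ⟨Module.finrank ℂ V, ?_, fun j => Wᴴ * X j * W, ?_, ?_⟩
  · simpa [Set.finrank] using finrank_range_le_card (R := ℂ) f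
  · rw [pencil_compress A X hW]
    exact hX.conjTranspose_mul_mul_same _
  · set Y := fun j => Wᴴ * X j * W
    let U : Matrix (Fin m × Fin n) (Fin m × Fin (Module.finrank ℂ V)) ℂ :=
      (1 : Matrix (Fin m) (Fin m) ℂ) ⊗ₖ W
    have hU : ‖U‖ ≤ 1 := norm_le_one_of_conjTranspose_mul_self <| by
      simp [U, Matrix.conjTranspose_kronecker, ← Matrix.mul_kronecker_mul, hW]
    have heq : fpEval Q X *ᵥ v.ofLp = (U * fpEval Q Y * Uᴴ) *ᵥ v.ofLp := by
      simp only [fpEval, Finsupp.sum, Matrix.mul_sum, Matrix.sum_mul, Matrix.sum_mulVec]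
      refine Finset.sum_congr rfl fun w hw => ?_
      simp only [U, Matrix.conjTranspose_kronecker, ← Matrix.mul_kronecker_mul,
        Matrix.conjTranspose_one, one_mul, mul_one]
      refine kronecker_mulVec_congr _ fun i => (wordProd_compress_mulVec X W _ w ?_).symm
      intro w' hw'
      have hmem : w' ∈ S := Finset.mem_biUnion.2 ⟨w, hw, by simpa using hw'⟩
      exact hP _ (Submodule.subset_span ⟨(i, ⟨w', hmem⟩), rfl⟩)
    have hnorm : ‖U * fpEval Q Y * Uᴴ‖ ≤ ‖fpEval Q Y‖ := by
      calc ‖U * fpEval Q Y * Uᴴ‖ ≤ ‖U‖ * ‖fpEval Q Y‖ * ‖Uᴴ‖ :=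
            (Matrix.l2_opNorm_mul _ _).trans
              (mul_le_mul_of_nonneg_right (Matrix.l2_opNorm_mul _ _) (norm_nonneg _))
        _ ≤ 1 * ‖fpEval Q Y‖ * 1 := by
            rw [Matrix.l2_opNorm_conjTranspose]
            gcongr
        _ = ‖fpEval Q Y‖ := by ring
    rw [heq, opN_eq_norm]
    exact (Matrix.l2_opNorm_mulVec _ v).trans
      (mul_le_mul_of_nonneg_right hnorm (norm_nonneg _))

/-- If `D_A` is bounded and `‖Q(X)‖ < 1` on all of `D_A`, then there is `s > 1` with
`s·‖Q(X)‖ ≤ 1` on `D_A`; in particular `sup {‖Q(X)‖ : X ∈ D_A} < 1`. -/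
theorem strict_contraction_on_bounded_spectrahedron {d g m : ℕ}
    (A : Fin g → Matrix (Fin d) (Fin d) ℂ) (hbdd : BoundedFS A)
    (Q : List (Fin g) →₀ Matrix (Fin m) (Fin m) ℂ)
    (hQ : ∀ (n : ℕ) (X : Fin g → Matrix (Fin n) (Fin n) ℂ),
      (pencil A X).PosSemidef → opN (fpEval Q X) < 1) :
    ∃ s : ℝ, 1 < s ∧
      ∀ (n : ℕ) (X : Fin g → Matrix (Fin n) (Fin n) ℂ),
        (pencil A X).PosSemidef → s * opN (fpEval Q X) ≤ 1 := by
  choose c hc1 hc using fun n => exists_uniform_bound_on_level hbdd Q n (hQ n)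
  obtain ⟨r, hr0, hr1, hr⟩ : ∃ r : ℝ, 0 < r ∧ r < 1 ∧
      ∀ k ≤ m * (Q.support.biUnion fun w => w.tails.toFinset).card, c k ≤ r := by
    generalize m * (Q.support.biUnion fun w => w.tails.toFinset).card = K
    obtain ⟨k₀, -, hk₀⟩ := (Finset.range (K + 1)).exists_max_image c ⟨0, by simp⟩
    refine ⟨max (c k₀) (1 / 2), by positivity, max_lt (hc1 k₀) (by norm_num), fun k hk => ?_⟩
    exact (hk₀ k (Finset.mem_range.2 (by omega))).trans (le_max_left _ _)
  refine ⟨r⁻¹, (one_lt_inv₀ hr0).2 hr1, fun n X hX => ?_⟩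
  rw [inv_mul_le_iff₀ hr0, mul_one]
  refine ContinuousLinearMap.opNorm_le_bound _ hr0.le fun v => ?_
  obtain ⟨k, hk, Y, hY, hv⟩ := exists_compression A Q X hX v
  exact hv.trans (mul_le_mul_of_nonneg_right ((hc k Y hY).trans (hr k hk)) (norm_nonneg _))
end
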